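/- Let d ≥ 1 be an integer, σ ∈ (0, π/2), ρ₊ > 0, ρ₋ > 0, and n ∈ ℕ. There exists a constant C = C(d, n, σ, ρ₊, ρ₋) > 0 such that for every λ ∈ ℂ with λ ≠ 0 and |arg λ| < π − σ, the following holds, where A_±(y) = √(ρ_± λ + ‖y‖²) (principal square roots): the complex number ρ₊A₋(y) + ρ₋A₊(y) has positive real part (in particular it never vanishes), and for each of the functions m(y) = A₊(y)/(ρ₊A₋(y) + ρ₋A₊(y)), m(y) = A₋(y)/(ρ₊A₋(y) + ρ₋A₊(y)), and, for each coordinate index j, m(y) = i y_j/(ρ₊A₋(y) + ρ₋A₊(y)), one has ‖D^n m(x)‖ ≤ C (|λ|^{1/2} + ‖x‖)^{−n} for all x ∈ ℝ^d with x ≠ 0. -/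

import Mathlib

open Real

/-- `A(ρ, λ)(y) = √(ρλ + ‖y‖²)`, the principal complex square root. -/
noncomputable def sqrtSymb (d : ℕ) (ρ : ℝ) (lam : ℂ) (y : EuclideanSpace ℝ (Fin d)) : ℂ :=
  ((ρ : ℂ) * lam + (‖y‖ : ℂ) ^ 2) ^ ((1 : ℂ) / 2)

/-- The normalized points `√‖μ‖ + ‖y‖ = 1` of the closed sector `-c ‖μ‖ ≤ re μ` times `E`. -/
def normalizedSector (E : Type*) [Norm E] (c : ℝ) : Set (ℂ × E) :=
  {p | -c * ‖p.1‖ ≤ p.1.re ∧ √‖p.1‖ + ‖p.2‖ = 1}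

theorem isCompact_normalizedSector (E : Type*) [NormedAddCommGroup E] [ProperSpace E] (c : ℝ) :
    IsCompact (normalizedSector E c) := by
  refine Metric.isCompact_of_isClosed_isBounded ?_ ?_
  · have hsector : IsClosed {p : ℂ × E | -c * ‖p.1‖ ≤ p.1.re} :=
      isClosed_le (by fun_prop) (by fun_prop)
    exact hsector.inter (isClosed_eq (by fun_prop) continuous_const)
  · refine (Metric.isBounded_closedBall (x := (0 : ℂ × E)) (r := 1)).subset ?_
    rintro ⟨μ, y⟩ ⟨-, h⟩
    simp only at h
    have h1 := Real.sqrt_nonneg ‖μ‖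
    have h2 := norm_nonneg y
    have h3 : ‖μ‖ ≤ 1 := Real.sqrt_le_one.mp (by linarith)
    rw [mem_closedBall_zero_iff, Prod.norm_def]
    exact max_le h3 (by simp only; linarith)

theorem ofReal_mul_add_ofReal_mem_slitPlane {c ρ r : ℝ} (hc : c < 1) (hρ : 0 < ρ) (hr : 0 ≤ r)
    {μ : ℂ} (hμ : -c * ‖μ‖ ≤ μ.re) (h0 : μ ≠ 0 ∨ r ≠ 0) :
    (ρ : ℂ) * μ + (r : ℂ) ∈ Complex.slitPlane := by
  rw [Complex.mem_slitPlane_iff]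
  simp only [Complex.add_re, Complex.re_ofReal_mul, Complex.ofReal_re, Complex.add_im,
    Complex.im_ofReal_mul, Complex.ofReal_im, add_zero]
  by_cases him : μ.im = 0
  · left
    have hnorm : ‖μ‖ = |μ.re| := (Complex.abs_re_eq_norm.mpr him).symm
    have hre : 0 ≤ μ.re := by
      by_contra! hneg
      rw [hnorm, abs_of_neg hneg] at hμ
      nlinarith
    rcases h0 with h0 | h0
    · have : 0 < μ.re := hre.lt_of_ne fun h => h0 (Complex.ext h.symm him)
      positivity
    · have : 0 < r := hr.lt_of_ne h0.symm
      positivity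
  · exact Or.inr (mul_ne_zero hρ.ne' him)

theorem Complex.re_cpow_half_pos {z : ℂ} (hz : z ∈ Complex.slitPlane) :
    0 < (z ^ ((1 : ℂ) / 2)).re := by
  rw [one_div, Complex.cpow_inv_two_re]
  refine Real.sqrt_pos.mpr (half_pos ?_)
  have h := Complex.abs_re_le_norm z
  rcases Complex.mem_slitPlane_iff.mp hz with h' | h'
  · linarith [norm_nonneg z]
  · have := Complex.abs_re_lt_norm.mpr h'
    linarith [neg_abs_le z.re]

theorem Complex.ofReal_mul_cpow_of_pos {a : ℝ} (ha : 0 < a) (z r : ℂ) :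
    ((a : ℂ) * z) ^ r = (a : ℂ) ^ r * z ^ r := by
  rcases eq_or_ne z 0 with rfl | hz
  · rcases eq_or_ne r 0 with rfl | hr
    · simp
    · simp [Complex.zero_cpow hr]
  · have ha' : (a : ℂ) ≠ 0 := Complex.ofReal_ne_zero.mpr ha.ne'
    rw [Complex.cpow_def_of_ne_zero (mul_ne_zero ha' hz), Complex.cpow_def_of_ne_zero ha',
      Complex.cpow_def_of_ne_zero hz, Complex.log_ofReal_mul ha hz, Complex.ofReal_log ha.le,
      add_mul, Complex.exp_add]

section SqrtSymb

variable {d : ℕ} {c ρ ρp ρm : ℝ} {lam : ℂ} {y : EuclideanSpace ℝ (Fin d)}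

theorem radicand_mem_slitPlane (hc : c < 1) (hρ : 0 < ρ)
    (hlam : -c * ‖lam‖ ≤ lam.re) (h0 : lam ≠ 0 ∨ y ≠ 0) :
    (ρ : ℂ) * lam + (‖y‖ : ℂ) ^ 2 ∈ Complex.slitPlane := by
  rw [← Complex.ofReal_pow]
  exact ofReal_mul_add_ofReal_mem_slitPlane hc hρ (sq_nonneg _) hlam
    (h0.imp_right fun h => pow_ne_zero 2 (norm_ne_zero_iff.mpr h))

theorem denominator_re_pos (hc : c < 1) (hρp : 0 < ρp) (hρm : 0 < ρm)
    (hlam : -c * ‖lam‖ ≤ lam.re) (h0 : lam ≠ 0 ∨ y ≠ 0) :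
    0 < ((ρp : ℂ) * sqrtSymb d ρm lam y + (ρm : ℂ) * sqrtSymb d ρp lam y).re := by
  have hp : 0 < (sqrtSymb d ρp lam y).re :=
    Complex.re_cpow_half_pos (radicand_mem_slitPlane hc hρp hlam h0)
  have hm : 0 < (sqrtSymb d ρm lam y).re :=
    Complex.re_cpow_half_pos (radicand_mem_slitPlane hc hρm hlam h0)
  simp only [Complex.add_re, Complex.re_ofReal_mul]
  positivity

theorem contDiffAt_sqrtSymb {n : WithTop ℕ∞} {p : ℂ × EuclideanSpace ℝ (Fin d)}
    (hp : (ρ : ℂ) * p.1 + (‖p.2‖ : ℂ) ^ 2 ∈ Complex.slitPlane) :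
    ContDiffAt ℝ n (fun q : ℂ × EuclideanSpace ℝ (Fin d) => sqrtSymb d ρ q.1 q.2) p := by
  have hsqrt : ContDiffAt ℝ n (fun z : ℂ => z ^ ((1 : ℂ) / 2))
      ((ρ : ℂ) * p.1 + (‖p.2‖ : ℂ) ^ 2) :=
    (analyticAt_id.cpow analyticAt_const hp).contDiffAt.restrict_scalars ℝ
  have hnorm : ContDiff ℝ n
      fun q : ℂ × EuclideanSpace ℝ (Fin d) => (‖q.2‖ : ℂ) ^ 2 := by
    simp only [← Complex.ofReal_pow]
    exact Complex.ofRealCLM.contDiff.comp (contDiff_snd.norm_sq ℝ)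
  exact hsqrt.comp p ((contDiff_const.mul contDiff_fst).add hnorm).contDiffAt

theorem sqrtSymb_eq_mul {s : ℝ} (hs : 0 < s) (ρ : ℝ) (lam : ℂ) (y : EuclideanSpace ℝ (Fin d)) :
    sqrtSymb d ρ lam y = s * sqrtSymb d ρ ((s⁻¹ ^ 2 : ℝ) • lam) (s⁻¹ • y) := by
  have hs' : (s : ℂ) ≠ 0 := Complex.ofReal_ne_zero.mpr hs.ne'
  have hroot : ((s ^ 2 : ℝ) : ℂ) ^ ((1 : ℂ) / 2) = s := by
    have := Complex.ofReal_cpow (sq_nonneg s) (1 / 2)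
    rw [← Real.sqrt_eq_rpow, Real.sqrt_sq hs.le] at this
    simpa using this.symm
  have hrad : (ρ : ℂ) * lam + (‖y‖ : ℂ) ^ 2 = ((s ^ 2 : ℝ) : ℂ) *
      ((ρ : ℂ) * ((s⁻¹ ^ 2 : ℝ) • lam) + (‖s⁻¹ • y‖ : ℂ) ^ 2) := by
    rw [norm_smul, Real.norm_of_nonneg (inv_nonneg.mpr hs.le), Complex.real_smul]
    push_cast
    field_simp
  rw [sqrtSymb, hrad, Complex.ofReal_mul_cpow_of_pos (by positivity), hroot, sqrtSymb]

end SqrtSymb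

theorem iteratedFDeriv_comp_clm_of_contDiffAt {𝕜 E F G : Type*} [NontriviallyNormedField 𝕜]
    [NormedAddCommGroup E] [NormedSpace 𝕜 E] [NormedAddCommGroup F] [NormedSpace 𝕜 F]
    [NormedAddCommGroup G] [NormedSpace 𝕜 G] {f : E → F} {n : ℕ} (g : G →L[𝕜] E) {x : G}
    (hf : ContDiffAt 𝕜 n f (g x)) :
    iteratedFDeriv 𝕜 n (f ∘ g) x =
      (iteratedFDeriv 𝕜 n f (g x)).compContinuousLinearMap fun _ => g := by
  obtain ⟨u, hu, hxu, hfu⟩ := hf.contDiffOn' le_rfl (by simp)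
  rw [Set.insert_eq_of_mem (Set.mem_univ _), Set.univ_inter] at hfu
  have hgu : IsOpen (g ⁻¹' u) := hu.preimage g.continuous
  have h := g.iteratedFDerivWithin_comp_right hfu hu.uniqueDiffOn hgu.uniqueDiffOn hxu le_rfl
  rwa [iteratedFDerivWithin_of_isOpen n hgu hxu, iteratedFDerivWithin_of_isOpen n hu hxu] at h

/-- A family `y ↦ F (lam, y)` that is invariant under `(lam, y) ↦ (t² lam, t y)` and smooth on the
normalized points of a sector satisfies symbol estimates of order zero. -/
theorem exists_iteratedFDeriv_bound_of_parabolic_invariant {E : Type*} [NormedAddCommGroup E]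
    [NormedSpace ℝ E] [ProperSpace E] (c : ℝ) (n : ℕ) (F : ℂ → E → ℂ)
    (hF : ∀ p ∈ normalizedSector E c, ContDiffAt ℝ n (fun q : ℂ × E => F q.1 q.2) p)
    (hinv : ∀ s : ℝ, 0 < s → ∀ lam y, F lam y = F ((s⁻¹ ^ 2 : ℝ) • lam) (s⁻¹ • y)) :
    ∃ C : ℝ, 0 < C ∧ ∀ lam : ℂ, lam ≠ 0 → -c * ‖lam‖ ≤ lam.re → ∀ x : E,
      ‖iteratedFDeriv ℝ n (F lam) x‖ ≤ C * (‖lam‖ ^ ((1 : ℝ) / 2) + ‖x‖) ^ (-(n : ℝ)) := by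
  set f : ℂ × E → ℂ := fun q => F q.1 q.2
  obtain ⟨M, hM⟩ := (isCompact_normalizedSector E c).exists_bound_of_continuousOn
    (f := iteratedFDeriv ℝ n f)
    fun p hp => ((hF p hp).continuousAt_iteratedFDeriv le_rfl).continuousWithinAt
  refine ⟨max M 1, by positivity, fun lam hlam hsec x => ?_⟩
  rw [← Real.sqrt_eq_rpow]
  set s := √‖lam‖ + ‖x‖ with hs_def
  have hs : 0 < s := add_pos_of_pos_of_nonneg (Real.sqrt_pos.mpr (norm_pos_iff.mpr hlam))
    (norm_nonneg x)
  have hsi : 0 ≤ s⁻¹ := inv_nonneg.mpr hs.le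
  set L : E →L[ℝ] ℂ × E := s⁻¹ • ContinuousLinearMap.inr ℝ ℂ E
  set a : ℂ × E := ((s⁻¹ ^ 2 : ℝ) • lam, 0)
  have hLnorm : ‖L‖ ≤ s⁻¹ := by
    refine L.opNorm_le_bound hsi fun y => ?_
    simp [L, norm_smul, abs_of_pos hs, mul_nonneg hsi (norm_nonneg y)]
  have haL : a + L x = ((s⁻¹ ^ 2 : ℝ) • lam, s⁻¹ • x) := by simp [a, L]
  have hmem : a + L x ∈ normalizedSector E c := by
    rw [haL]
    refine ⟨?_, ?_⟩
    · simp only [norm_smul, Complex.smul_re, smul_eq_mul, Real.norm_of_nonneg (sq_nonneg s⁻¹)]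
      nlinarith [mul_le_mul_of_nonneg_left hsec (sq_nonneg s⁻¹)]
    · simp only [norm_smul, Real.norm_of_nonneg (sq_nonneg s⁻¹), Real.norm_of_nonneg hsi]
      rw [Real.sqrt_mul (sq_nonneg _), Real.sqrt_sq hsi, ← mul_add, ← hs_def,
        inv_mul_cancel₀ hs.ne']
  have hcomp : F lam = (fun q => f (a + q)) ∘ L := by
    ext y
    simp [f, a, L, hinv s hs lam y]
  have hsmooth : ContDiffAt ℝ n (fun q => f (a + q)) (L x) :=
    (hF _ hmem).comp (L x) (contDiff_const.add contDiff_id).contDiffAt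
  rw [hcomp, iteratedFDeriv_comp_clm_of_contDiffAt L hsmooth, iteratedFDeriv_comp_add_left,
    Real.rpow_neg hs.le, Real.rpow_natCast, ← inv_pow]
  refine (ContinuousMultilinearMap.norm_compContinuousLinearMap_le _ _).trans ?_
  rw [Finset.prod_const, Finset.card_univ, Fintype.card_fin]
  gcongr
  exact (hM _ hmem).trans (le_max_left _ _)

theorem Complex.neg_cos_mul_norm_le_re {σ : ℝ} (hσ : 0 ≤ σ) {z : ℂ} (hz : |z.arg| ≤ π - σ) :
    -Real.cos σ * ‖z‖ ≤ z.re := by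
  rw [← Complex.norm_mul_cos_arg z, mul_comm, ← Real.cos_pi_sub, ← Real.cos_abs z.arg]
  exact mul_le_mul_of_nonneg_left
    (Real.cos_le_cos_of_nonneg_of_le_pi (abs_nonneg _) (by linarith) hz) (norm_nonneg z)

/-- Multiplier estimate (3.9): the denominator `ρ₊A₋ + ρ₋A₊` has positive real part and the
symbols `A₊/(ρ₊A₋+ρ₋A₊)`, `A₋/(ρ₊A₋+ρ₋A₊)`, `iy_j/(ρ₊A₋+ρ₋A₊)` satisfy the derivative bounds
`‖D^n m(x)‖ ≤ C (|λ|^{1/2} + ‖x‖)^{-n}`. -/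
theorem stmt_11 (d : ℕ) (hd : 1 ≤ d) (σ : ℝ) (hσ : σ ∈ Set.Ioo 0 (π / 2))
    (ρp ρm : ℝ) (hρp : 0 < ρp) (hρm : 0 < ρm) (n : ℕ) :
    ∃ C : ℝ, 0 < C ∧ ∀ lam : ℂ, lam ≠ 0 → |lam.arg| < π - σ →
      (∀ y : EuclideanSpace ℝ (Fin d),
        0 < ((ρp : ℂ) * sqrtSymb d ρm lam y + (ρm : ℂ) * sqrtSymb d ρp lam y).re) ∧
      (∀ x : EuclideanSpace ℝ (Fin d), x ≠ 0 →
        ‖iteratedFDeriv ℝ n (fun y : EuclideanSpace ℝ (Fin d) =>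
            sqrtSymb d ρp lam y /
              ((ρp : ℂ) * sqrtSymb d ρm lam y + (ρm : ℂ) * sqrtSymb d ρp lam y)) x‖ ≤
          C * (‖lam‖ ^ ((1 : ℝ) / 2) + ‖x‖) ^ (-(n : ℝ))) ∧
      (∀ x : EuclideanSpace ℝ (Fin d), x ≠ 0 →
        ‖iteratedFDeriv ℝ n (fun y : EuclideanSpace ℝ (Fin d) =>
            sqrtSymb d ρm lam y /
              ((ρp : ℂ) * sqrtSymb d ρm lam y + (ρm : ℂ) * sqrtSymb d ρp lam y)) x‖ ≤
          C * (‖lam‖ ^ ((1 : ℝ) / 2) + ‖x‖) ^ (-(n : ℝ))) ∧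
      (∀ j : Fin d, ∀ x : EuclideanSpace ℝ (Fin d), x ≠ 0 →
        ‖iteratedFDeriv ℝ n (fun y : EuclideanSpace ℝ (Fin d) =>
            Complex.I * (y j : ℂ) /
              ((ρp : ℂ) * sqrtSymb d ρm lam y + (ρm : ℂ) * sqrtSymb d ρp lam y)) x‖ ≤
          C * (‖lam‖ ^ ((1 : ℝ) / 2) + ‖x‖) ^ (-(n : ℝ))) := by
  have hc : Real.cos σ < 1 := by
    rw [← Real.cos_zero]
    exact Real.cos_lt_cos_of_nonneg_of_le_pi le_rfl (by linarith [hσ.2, Real.pi_pos]) hσ.1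
  set D : ℂ → EuclideanSpace ℝ (Fin d) → ℂ := fun lam y =>
    (ρp : ℂ) * sqrtSymb d ρm lam y + (ρm : ℂ) * sqrtSymb d ρp lam y with hD
  have hne : ∀ p ∈ normalizedSector (EuclideanSpace ℝ (Fin d)) (Real.cos σ),
      p.1 ≠ 0 ∨ p.2 ≠ 0 := by
    rintro p ⟨-, hp⟩
    by_contra! h
    simp [h.1, h.2] at hp
  have hsmooth : ∀ ρ : ℝ, 0 < ρ →
      ∀ p ∈ normalizedSector (EuclideanSpace ℝ (Fin d)) (Real.cos σ),
      ContDiffAt ℝ n (fun q : ℂ × EuclideanSpace ℝ (Fin d) => sqrtSymb d ρ q.1 q.2) p :=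
    fun ρ hρ p hp => contDiffAt_sqrtSymb (radicand_mem_slitPlane hc hρ hp.1 (hne p hp))
  have hquot : ∀ N : ℂ → EuclideanSpace ℝ (Fin d) → ℂ,
      (∀ p ∈ normalizedSector (EuclideanSpace ℝ (Fin d)) (Real.cos σ),
        ContDiffAt ℝ n (fun q : ℂ × EuclideanSpace ℝ (Fin d) => N q.1 q.2) p) →
      (∀ s : ℝ, 0 < s → ∀ lam y, N lam y = s * N ((s⁻¹ ^ 2 : ℝ) • lam) (s⁻¹ • y)) →
      ∃ C : ℝ, 0 < C ∧ ∀ lam : ℂ, lam ≠ 0 → -Real.cos σ * ‖lam‖ ≤ lam.re → ∀ x,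
        ‖iteratedFDeriv ℝ n (fun y => N lam y / D lam y) x‖ ≤
          C * (‖lam‖ ^ ((1 : ℝ) / 2) + ‖x‖) ^ (-(n : ℝ)) := by
    intro N hN hNinv
    refine exists_iteratedFDeriv_bound_of_parabolic_invariant _ n (fun lam y => N lam y / D lam y)
      (fun p hp => ?_) fun s hs lam y => ?_
    · have hDp : ContDiffAt ℝ n (fun q : ℂ × EuclideanSpace ℝ (Fin d) => D q.1 q.2) p :=
        (contDiffAt_const.mul (hsmooth ρm hρm p hp)).add
          (contDiffAt_const.mul (hsmooth ρp hρp p hp))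
      have hDne : D p.1 p.2 ≠ 0 := fun h => by
        have := denominator_re_pos hc hρp hρm hp.1 (hne p hp)
        simp only [hD] at h
        simp [h] at this
      simp only [div_eq_mul_inv]
      exact (hN p hp).mul (hDp.inv hDne)
    · have hDinv : D lam y = s * D ((s⁻¹ ^ 2 : ℝ) • lam) (s⁻¹ • y) := by
        simp only [hD]
        rw [sqrtSymb_eq_mul hs ρm lam y, sqrtSymb_eq_mul hs ρp lam y]
        ring
      rw [hNinv s hs lam y, hDinv, mul_div_mul_left _ _ (Complex.ofReal_ne_zero.mpr hs.ne')]
  obtain ⟨Cp, hCp, hp⟩ := hquot (sqrtSymb d ρp) (hsmooth ρp hρp) fun s hs => sqrtSymb_eq_mul hs ρp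
  obtain ⟨Cm, hCm, hm⟩ := hquot (sqrtSymb d ρm) (hsmooth ρm hρm) fun s hs => sqrtSymb_eq_mul hs ρm
  have hcoord : ∀ j : Fin d, _ := fun j => hquot (fun _ y => Complex.I * (y j : ℂ))
    (fun p _ => (contDiff_const.mul (Complex.ofRealCLM.contDiff.comp
      ((EuclideanSpace.proj (𝕜 := ℝ) j).contDiff.comp contDiff_snd))).contDiffAt)
    (fun s hs _ y => by
      have : (s : ℂ) ≠ 0 := Complex.ofReal_ne_zero.mpr hs.ne'
      simp only [PiLp.smul_apply, smul_eq_mul, Complex.ofReal_mul, Complex.ofReal_inv]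
      field_simp)
  choose Cj hCj hj using hcoord
  have hsum : 0 ≤ ∑ j, Cj j := Finset.sum_nonneg fun j _ => (hCj j).le
  refine ⟨Cp + Cm + ∑ j, Cj j, by positivity, fun lam hlam harg => ?_⟩
  have hsec := Complex.neg_cos_mul_norm_le_re hσ.1.le harg.le
  refine ⟨fun y => denominator_re_pos hc hρp hρm hsec (Or.inl hlam),
    fun x _ => (hp lam hlam hsec x).trans ?_, fun x _ => (hm lam hlam hsec x).trans ?_,
    fun j x _ => (hj j lam hlam hsec x).trans ?_⟩
  · gcongr
    linarith
  · gcongr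
    linarith
  · gcongr
    linarith [Finset.single_le_sum (fun i _ => (hCj i).le) (Finset.mem_univ j)]
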